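/- For n ≥ 2, the Smith normal form of the matrix A_n = [[−E_n, −X_nᵀ],[−X_n, −n·E_{n(n-1)/2}]] (of size n + n(n-1)/2, where X_n has rows e_i − e_j for i < j) is E_{2n−2} ⊕ n·E_{(n−2)(n−3)/2} ⊕ O; equivalently, its elementary divisors are 2n−2 ones, (n−2)(n−3)/2 copies of n, and n−1 zeros. -/

import Mathlib

open Matrix Finset

/-- Index type for the rows of `X n`: pairs `(i,j)` with `i < j` in `Fin n`. -/
abbrev PairIdx (n : ℕ) := {p : Fin n × Fin n // p.1 < p.2}

/-- The matrix `X n` whose row indexed by `(i,j)` (with `i < j`) is `e i - e j`. -/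
def Xmat (n : ℕ) : Matrix (PairIdx n) (Fin n) ℤ :=
  Matrix.of fun p k => (if k = p.1.1 then 1 else 0) - (if k = p.1.2 then 1 else 0)

/-- The weighted incidence matrix `A n = [[−E, −Xᵀ],[−X, −n·E]]`. -/
def Amat (n : ℕ) : Matrix (Fin n ⊕ PairIdx n) (Fin n ⊕ PairIdx n) ℤ :=
  Matrix.fromBlocks (-1) (-(Xmat n)ᵀ) (-(Xmat n)) (-((n : ℤ) • 1))

/-- Equivalence of integer matrices up to invertible (possibly reindexing) factors. -/
def UnimodEquiv {m n m' n' : Type*} [Fintype m] [Fintype n] [Fintype m'] [Fintype n']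
    [DecidableEq m] [DecidableEq n] [DecidableEq m'] [DecidableEq n']
    (A : Matrix m n ℤ) (B : Matrix m' n' ℤ) : Prop :=
  ∃ (U : Matrix m' m ℤ) (U' : Matrix m m' ℤ) (V : Matrix n n' ℤ) (V' : Matrix n' n ℤ),
    U * U' = 1 ∧ U' * U = 1 ∧ V * V' = 1 ∧ V' * V = 1 ∧ U * A * V = B

namespace UnimodEquiv

variable {m n m' n' m'' n'' p q : Type*} [Fintype m] [Fintype n] [Fintype m'] [Fintype n']
  [Fintype m''] [Fintype n''] [Fintype p] [Fintype q]
  [DecidableEq m] [DecidableEq n] [DecidableEq m'] [DecidableEq n']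
  [DecidableEq m''] [DecidableEq n''] [DecidableEq p] [DecidableEq q]

theorem trans {A : Matrix m n ℤ} {B : Matrix m' n' ℤ} {C : Matrix m'' n'' ℤ}
    (h₁ : UnimodEquiv A B) (h₂ : UnimodEquiv B C) : UnimodEquiv A C := by
  obtain ⟨U, U', V, V', hU, hU', hV, hV', rfl⟩ := h₁
  obtain ⟨W, W', Z, Z', hW, hW', hZ, hZ', rfl⟩ := h₂
  refine ⟨W * U, U' * W', V * Z, Z' * V', ?_, ?_, ?_, ?_, ?_⟩
  · rw [Matrix.mul_assoc, ← Matrix.mul_assoc U, hU, Matrix.one_mul, hW]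
  · rw [Matrix.mul_assoc, ← Matrix.mul_assoc W', hW', Matrix.one_mul, hU']
  · rw [Matrix.mul_assoc, ← Matrix.mul_assoc Z, hZ, Matrix.one_mul, hV]
  · rw [Matrix.mul_assoc, ← Matrix.mul_assoc V', hV', Matrix.one_mul, hZ']
  · simp only [Matrix.mul_assoc]

theorem submatrix (A : Matrix m n ℤ) (e : m' ≃ m) (f : n' ≃ n) :
    UnimodEquiv A (A.submatrix e f) := by
  refine ⟨(1 : Matrix m m ℤ).submatrix e id, (1 : Matrix m m ℤ).submatrix id e,
    (1 : Matrix n n ℤ).submatrix id f, (1 : Matrix n n ℤ).submatrix f id, ?_, ?_, ?_, ?_, ?_⟩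
  · rw [← submatrix_mul _ _ _ _ _ Function.bijective_id]; simp
  · rw [← submatrix_mul _ _ _ _ _ e.bijective]; simp
  · rw [← submatrix_mul _ _ _ _ _ f.bijective]; simp
  · rw [← submatrix_mul _ _ _ _ _ Function.bijective_id]; simp
  · have h : A = A.submatrix id id := rfl
    conv_lhs => rw [h]
    rw [← submatrix_mul _ _ _ _ _ Function.bijective_id,
      ← submatrix_mul _ _ _ _ _ Function.bijective_id]
    simp

theorem fromBlocks_diag (A : Matrix p q ℤ) {B : Matrix m n ℤ} {C : Matrix m' n' ℤ}
    (h : UnimodEquiv B C) : UnimodEquiv (fromBlocks A 0 0 B) (fromBlocks A 0 0 C) := by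
  obtain ⟨U, U', V, V', hU, hU', hV, hV', rfl⟩ := h
  refine ⟨fromBlocks 1 0 0 U, fromBlocks 1 0 0 U', fromBlocks 1 0 0 V, fromBlocks 1 0 0 V',
    ?_, ?_, ?_, ?_, ?_⟩ <;> simp [fromBlocks_multiply, *]

/-- Clear the off-diagonal blocks against a `-1` block. -/
theorem schur (X : Matrix m n ℤ) (D : Matrix m m ℤ) :
    UnimodEquiv (fromBlocks (-1) (-Xᵀ) (-X) D) (fromBlocks (1 : Matrix n n ℤ) 0 0 (X * Xᵀ + D)) := by
  refine ⟨fromBlocks (-1) 0 (-X) 1, fromBlocks (-1) 0 (-X) 1,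
    fromBlocks 1 (-Xᵀ) 0 1, fromBlocks 1 Xᵀ 0 1, ?_, ?_, ?_, ?_, ?_⟩ <;>
  simp [fromBlocks_multiply]

/-- When `Xᵀ * X = (c - 1) • 1 - J` and `X * J = 0`, the first block column can be cleared. -/
theorem clear_first_column (X : Matrix m n ℤ) (J : Matrix n n ℤ) (c : ℤ)
    (hJ : X * J = 0) (hX : Xᵀ * X = (c - 1) • 1 - J) :
    UnimodEquiv (fromBlocks (J + 1 - c • 1) (-Xᵀ) (-X) (X * Xᵀ - c • (1 : Matrix m m ℤ)))
      (fromBlocks (0 : Matrix n n ℤ) (-Xᵀ) 0 (-(c • (1 : Matrix m m ℤ)))) := by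
  refine ⟨fromBlocks 1 0 X 1, fromBlocks 1 0 (-X) 1,
    fromBlocks 1 0 (-X) 1, fromBlocks 1 0 X 1, ?_, ?_, ?_, ?_, ?_⟩
  · simp [fromBlocks_multiply]
  · simp [fromBlocks_multiply]
  · simp [fromBlocks_multiply]
  · simp [fromBlocks_multiply]
  · simp only [fromBlocks_multiply]
    congr 1
    · simp [hX]; module
    · simp
    · simp only [Matrix.mul_add, Matrix.mul_sub, Matrix.add_mul, Matrix.sub_mul, hJ,
        Matrix.mul_assoc, Matrix.mul_neg, Matrix.neg_mul, hX, Matrix.mul_smul, Matrix.smul_mul,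
        Matrix.mul_one, Matrix.one_mul]
      module
    · simp only [Matrix.mul_zero, Matrix.mul_one, Matrix.one_mul, Matrix.mul_neg]
      module

/-- A block column formed by an incidence-type matrix over a scalar matrix is diagonalizable. -/
theorem diagonalize (Y : Matrix m n ℤ) (j : Matrix n Unit ℤ) (c : ℤ) (hj : Y * j = 0) :
    UnimodEquiv
      (fromBlocks (0 : Matrix (Unit ⊕ n) (Unit ⊕ n) ℤ) (-(fromBlocks j (-1) 0 Y)ᵀ) 0
        (-(c • (1 : Matrix (n ⊕ m) (n ⊕ m) ℤ))))
      (fromBlocks (0 : Matrix (Unit ⊕ n) (Unit ⊕ n) ℤ) 0 0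
        (fromBlocks (1 : Matrix n n ℤ) 0 0 (c • (1 : Matrix m m ℤ)))) := by
  have hj' : jᵀ * Yᵀ = 0 := by rw [← transpose_mul, hj, transpose_zero]
  have h1 : (1 : Matrix (n ⊕ m) (n ⊕ m) ℤ) = fromBlocks 1 0 0 1 := fromBlocks_one.symm
  have h2 : (1 : Matrix (Unit ⊕ n) (Unit ⊕ n) ℤ) = fromBlocks 1 0 0 1 := fromBlocks_one.symm
  have h0 : (0 : Matrix (Unit ⊕ n) (Unit ⊕ n) ℤ) = fromBlocks 0 0 0 0 := fromBlocks_zero.symm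
  refine ⟨fromBlocks (fromBlocks 1 jᵀ 0 (c • 1)) (fromBlocks 0 0 1 (-Yᵀ))
      (fromBlocks 0 1 0 0) (fromBlocks 0 0 0 (-1)),
    fromBlocks (fromBlocks 1 0 0 0) (fromBlocks (-jᵀ) 0 1 0)
      (fromBlocks 0 1 0 0) (fromBlocks (-(c • 1)) (-Yᵀ) 0 (-1)),
    fromBlocks 1 0 0 (fromBlocks 1 Yᵀ 0 1), fromBlocks 1 0 0 (fromBlocks 1 (-Yᵀ) 0 1),
    ?_, ?_, ?_, ?_, ?_⟩ <;>
  simp [fromBlocks_multiply, fromBlocks_add, fromBlocks_transpose, fromBlocks_neg,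
    fromBlocks_smul, h1, hj', h2, h0, -fromBlocks_one,
    -fromBlocks_zero, -zsmul_eq_mul, -zsmul_one] <;>
  simp

end UnimodEquiv

/-- `Fin (n + 1)` splits as `0` and the successors. -/
noncomputable def unitSumFinEquiv (n : ℕ) : Unit ⊕ Fin n ≃ Fin (n + 1) :=
  Equiv.ofBijective (Sum.elim (fun _ => 0) Fin.succ) <| by
    constructor
    · rintro (a | a) (b | b) h <;> simp_all [Fin.succ_ne_zero, (Fin.succ_ne_zero _).symm]
    · intro i
      refine Fin.cases ⟨Sum.inl (), rfl⟩ (fun j => ⟨Sum.inr j, rfl⟩) i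

/-- Pairs in `Fin (n + 1)` split as those containing `0` and those that do not. -/
noncomputable def finSumPairIdxEquiv (n : ℕ) : Fin n ⊕ PairIdx n ≃ PairIdx (n + 1) :=
  Equiv.ofBijective
    (Sum.elim (fun j => ⟨(0, j.succ), Fin.succ_pos j⟩)
      fun p => ⟨(p.1.1.succ, p.1.2.succ), Fin.succ_lt_succ_iff.2 p.2⟩) <| by
    constructor
    · rintro (a | ⟨⟨a, b⟩, h⟩) (c | ⟨⟨c, d⟩, h'⟩) h <;>
        simp_all [Fin.succ_ne_zero, (Fin.succ_ne_zero _).symm]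
    · rintro ⟨⟨i, j⟩, h⟩
      induction i using Fin.cases with
      | zero =>
        induction j using Fin.cases with
        | zero => exact absurd h (lt_irrefl _)
        | succ j => exact ⟨Sum.inl j, rfl⟩
      | succ i =>
        induction j using Fin.cases with
        | zero => exact absurd h (Fin.not_lt_zero _)
        | succ j => exact ⟨Sum.inr ⟨(i, j), Fin.succ_lt_succ_iff.1 h⟩, rfl⟩

@[simp]
theorem unitSumFinEquiv_inl (n : ℕ) (u : Unit) : unitSumFinEquiv n (Sum.inl u) = 0 := rfl

@[simp]
theorem unitSumFinEquiv_inr (n : ℕ) (i : Fin n) : unitSumFinEquiv n (Sum.inr i) = i.succ := rfl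

@[simp]
theorem finSumPairIdxEquiv_inl (n : ℕ) (j : Fin n) :
    (finSumPairIdxEquiv n (Sum.inl j)).1 = (0, j.succ) := rfl

@[simp]
theorem finSumPairIdxEquiv_inr (n : ℕ) (p : PairIdx n) :
    (finSumPairIdxEquiv n (Sum.inr p)).1 = (p.1.1.succ, p.1.2.succ) := rfl

theorem card_pairIdx (n : ℕ) : Fintype.card (PairIdx n) = n * (n - 1) / 2 := by
  rw [← Finset.sum_range_id]
  induction n with
  | zero => simp
  | succ n ih =>
    rw [← Fintype.card_congr (finSumPairIdxEquiv n), Fintype.card_sum, ih, Finset.sum_range_succ,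
      Fintype.card_fin, add_comm]

theorem Xmat_succ_submatrix (n : ℕ) :
    (Xmat (n + 1)).submatrix (finSumPairIdxEquiv n) (unitSumFinEquiv n) =
      fromBlocks (of fun _ _ => 1) (-1) 0 (Xmat n) := by
  ext (i | i) (j | j) <;>
  simp [Xmat, Fin.succ_ne_zero, (Fin.succ_ne_zero _).symm, Matrix.one_apply, eq_comm]

theorem Xmat_mul_ones (n : ℕ) (m : Type*) :
    Xmat n * (of fun _ _ => 1 : Matrix (Fin n) m ℤ) = 0 := by
  ext p j
  simp [Xmat, Matrix.mul_apply]

theorem Xmat_mul_transpose_succ (n : ℕ) :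
    (Xmat (n + 1) * (Xmat (n + 1))ᵀ).submatrix (finSumPairIdxEquiv n) (finSumPairIdxEquiv n) =
      fromBlocks ((of fun _ _ => 1) + 1) (-(Xmat n)ᵀ) (-(Xmat n)) (Xmat n * (Xmat n)ᵀ) := by
  rw [submatrix_mul _ _ _ (unitSumFinEquiv n) _ (unitSumFinEquiv n).bijective,
    ← transpose_submatrix, Xmat_succ_submatrix, fromBlocks_transpose, fromBlocks_multiply]
  congr 1
  · ext i j; simp [Matrix.mul_apply]
  all_goals simp

theorem Xmat_transpose_mul (n : ℕ) :
    (Xmat n)ᵀ * Xmat n = (n : ℤ) • 1 - of fun _ _ => 1 := by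
  induction n with
  | zero => ext i; exact i.elim0
  | succ n ih =>
    apply (Equiv.injective (reindex (unitSumFinEquiv n).symm (unitSumFinEquiv n).symm))
    simp only [reindex_apply, Equiv.symm_symm]
    rw [submatrix_mul _ _ _ (finSumPairIdxEquiv n) _ (finSumPairIdxEquiv n).bijective,
      ← transpose_submatrix, Xmat_succ_submatrix, fromBlocks_transpose, fromBlocks_multiply]
    simp only [transpose_neg, transpose_zero, transpose_one, ih]
    ext (i | i) (j | j) <;>
      simp [Matrix.mul_apply, Matrix.one_apply, Matrix.smul_apply, -zsmul_eq_mul,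
        -zsmul_one, Fin.succ_ne_zero, (Fin.succ_ne_zero _).symm]
    rw [Matrix.natCast_apply]
    split_ifs <;> ring

/-- The Smith normal form of `Amat (k + 2)`, on an index type split according to its entries. -/
theorem Amat_unimodEquiv (k : ℕ) :
    UnimodEquiv (Amat (k + 2))
      (diagonal (Sum.elim 1 (Sum.elim 0 (Sum.elim 1 fun _ => ((k + 2 : ℕ) : ℤ))) :
        Fin (k + 2) ⊕ ((Unit ⊕ Fin k) ⊕ (Fin k ⊕ PairIdx k)) → ℤ)) := by
  set c : ℤ := ((k + 2 : ℕ) : ℤ) with hc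
  have key : UnimodEquiv (Xmat (k + 2) * (Xmat (k + 2))ᵀ + -(c • 1))
      (fromBlocks (0 : Matrix (Unit ⊕ Fin k) (Unit ⊕ Fin k) ℤ) 0 0
        (fromBlocks (1 : Matrix (Fin k) (Fin k) ℤ) 0 0
          (c • (1 : Matrix (PairIdx k) (PairIdx k) ℤ)))) := by
    refine (UnimodEquiv.submatrix _ (finSumPairIdxEquiv (k + 1))
      (finSumPairIdxEquiv (k + 1))).trans ?_
    have h₁ : (Xmat (k + 2) * (Xmat (k + 2))ᵀ + -(c • 1)).submatrix
        (finSumPairIdxEquiv (k + 1)) (finSumPairIdxEquiv (k + 1)) =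
        fromBlocks ((of fun _ _ => 1) + 1 - c • 1) (-(Xmat (k + 1))ᵀ) (-(Xmat (k + 1)))
          (Xmat (k + 1) * (Xmat (k + 1))ᵀ - c • 1) := by
      rw [submatrix_add, Pi.add_apply, Pi.add_apply, Xmat_mul_transpose_succ, submatrix_neg,
        Pi.neg_apply, Pi.neg_apply, submatrix_smul, Pi.smul_apply, Pi.smul_apply,
        submatrix_one_equiv, ← fromBlocks_one, fromBlocks_smul, fromBlocks_neg, fromBlocks_add]
      simp [sub_eq_add_neg]
    rw [h₁]
    refine (UnimodEquiv.clear_first_column _ _ c (Xmat_mul_ones _ _) ?_).trans ?_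
    · rw [Xmat_transpose_mul, hc]; push_cast; congr 2; ring
    refine (UnimodEquiv.submatrix _
      ((unitSumFinEquiv k).sumCongr (finSumPairIdxEquiv k))
      ((unitSumFinEquiv k).sumCongr (finSumPairIdxEquiv k))).trans ?_
    have h₂ : (fromBlocks (0 : Matrix (Fin (k + 1)) (Fin (k + 1)) ℤ) (-(Xmat (k + 1))ᵀ) 0
        (-(c • 1))).submatrix ((unitSumFinEquiv k).sumCongr (finSumPairIdxEquiv k))
        ((unitSumFinEquiv k).sumCongr (finSumPairIdxEquiv k)) =
        fromBlocks 0 (-(fromBlocks (of fun _ _ => 1) (-1) 0 (Xmat k))ᵀ) 0 (-(c • 1)) := by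
      rw [← Xmat_succ_submatrix]
      ext (i | i) (j | j) <;>
        simp [Matrix.one_apply, Matrix.smul_apply, -zsmul_eq_mul, -zsmul_one]
    rw [h₂]
    exact UnimodEquiv.diagonalize _ _ c (Xmat_mul_ones _ _)
  have h₃ := (UnimodEquiv.schur (Xmat (k + 2)) (-(c • 1))).trans (key.fromBlocks_diag 1)
  have h0 : (0 : Matrix (Unit ⊕ Fin k) (Unit ⊕ Fin k) ℤ) = diagonal 0 := diagonal_zero.symm
  have h₄ : fromBlocks (1 : Matrix (Fin (k + 2)) (Fin (k + 2)) ℤ) 0 0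
      (fromBlocks (0 : Matrix (Unit ⊕ Fin k) (Unit ⊕ Fin k) ℤ) 0 0
        (fromBlocks (1 : Matrix (Fin k) (Fin k) ℤ) 0 0
          (c • (1 : Matrix (PairIdx k) (PairIdx k) ℤ)))) =
      diagonal (Sum.elim 1 (Sum.elim 0 (Sum.elim 1 fun _ => c))) := by
    rw [smul_one_eq_diagonal, ← diagonal_one, ← diagonal_one, h0, fromBlocks_diagonal,
      fromBlocks_diagonal, fromBlocks_diagonal]
    rfl
  rw [← h₄]
  exact h₃

/-- For `n ≥ 2`, the Smith normal form of `A n` is `E_{2n−2} ⊕ n·E_{(n−2)(n−3)/2} ⊕ O`: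
`A n` is `ℤ`-equivalent to a diagonal matrix whose diagonal entries are
`2n−2` ones, `(n−2)(n−3)/2` copies of `n`, and `n−1` zeros. -/
theorem stmt6 (n : ℕ) (hn : 2 ≤ n) :
    ∃ (U V : Matrix (Fin n ⊕ PairIdx n) (Fin n ⊕ PairIdx n) ℤ)
      (d : Fin n ⊕ PairIdx n → ℤ),
      IsUnit U.det ∧ IsUnit V.det ∧
      U * Amat n * V = Matrix.diagonal d ∧
      (∀ i, d i = 1 ∨ d i = (n : ℤ) ∨ d i = 0) ∧
      (univ.filter fun i => d i = 1).card = 2 * n - 2 ∧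
      (univ.filter fun i => d i = (n : ℤ)).card = (n - 2) * (n - 3) / 2 ∧
      (univ.filter fun i => d i = 0).card = n - 1 := by
  obtain ⟨k, rfl⟩ := Nat.exists_eq_add_of_le' hn
  obtain ⟨U, U', V, V', hU, hU', hV, hV', h⟩ := Amat_unimodEquiv k
  let e : Fin (k + 2) ⊕ PairIdx (k + 2) ≃
      Fin (k + 2) ⊕ ((Unit ⊕ Fin k) ⊕ (Fin k ⊕ PairIdx k)) :=
    (Equiv.refl _).sumCongr ((finSumPairIdxEquiv (k + 1)).symm.trans
      ((unitSumFinEquiv k).symm.sumCongr (finSumPairIdxEquiv k).symm))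
  set d : Fin (k + 2) ⊕ ((Unit ⊕ Fin k) ⊕ (Fin k ⊕ PairIdx k)) → ℤ :=
    Sum.elim 1 (Sum.elim 0 (Sum.elim 1 fun _ => ((k + 2 : ℕ) : ℤ))) with hd
  have hcard (a : ℤ) : (univ.filter fun i => d (e i) = a).card =
      (univ.filter fun i => d i = a).card := by
    simp only [card_filter]
    exact e.sum_comp fun i => if d i = a then 1 else 0
  have hc0 : ((k : ℤ) + 2 = 0) = False := by simp; omega
  have hc1 : ((k : ℤ) + 2 = 1) = False := by simp; omega
  have hc0' : (0 = (k : ℤ) + 2) = False := by simp; omega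
  have hc1' : (1 = (k : ℤ) + 2) = False := by simp; omega
  refine ⟨U.submatrix e id, V.submatrix id e, d ∘ e, ?_, ?_, ?_, ?_, ?_, ?_, ?_⟩
  · refine isUnit_det_of_right_inverse (B := U'.submatrix id e) ?_
    rw [← submatrix_mul _ _ _ _ _ Function.bijective_id, hU, submatrix_one_equiv]
  · refine isUnit_det_of_left_inverse (B := V'.submatrix e id) ?_
    rw [← submatrix_mul _ _ _ _ _ Function.bijective_id, hV', submatrix_one_equiv]
  · rw [← submatrix_diagonal_equiv, ← h, submatrix_mul _ _ _ _ _ Function.bijective_id,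
      submatrix_mul _ _ _ _ _ Function.bijective_id, submatrix_id_id]
  · intro i
    rcases h' : e i with i | (i | i) | (i | i) <;> simp [hd, h']
  all_goals
    simp only [Function.comp_apply, hcard, card_filter, Fintype.sum_sum_type]
    simp [hd, hc0, hc1, hc0', hc1', card_pairIdx]
  all_goals omega
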